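/- arXiv:math/9907033 — 4 statements merged into one kernel-verified Lean document; each statement's English description precedes it below -/
import Mathlib

section
/- Let E and B be topological spaces with E compact, B Hausdorff, let p : E → B be a continuous open map, let γ be a flow on B and let γ' be a flow on E that is a lift of γ along p. If (N₁, N₀) is an index pair for an isolated invariant set S of γ, then (p⁻¹(N₁), p⁻¹(N₀)) is an index pair for the isolated invariant set p⁻¹(S) of γ'. -/
/-- A flow on a topological space `X`. -/
def IsFlow {X : Type*} [TopologicalSpace X] (γ : ℝ × X → X) : Prop :=
  Continuous γ ∧ (∀ x, γ (0, x) = x) ∧ ∀ t s x, γ (t, γ (s, x)) = γ (t + s, x)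

/-- A set `S` is invariant under the flow `γ`. -/
def FlowInvariant {X : Type*} (γ : ℝ × X → X) (S : Set X) : Prop :=
  ∀ x ∈ S, ∀ t : ℝ, γ (t, x) ∈ S

/-- The maximal invariant subset `I(M)` of `M`. -/
def MaxInvariant {X : Type*} (γ : ℝ × X → X) (M : Set X) : Set X :=
  {x ∈ M | ∀ t : ℝ, γ (t, x) ∈ M}

/-- `M` is an isolating neighborhood of `S` for the flow `γ`. -/
def IsIsolatingNbhd {X : Type*} [TopologicalSpace X] (γ : ℝ × X → X) (S M : Set X) : Prop :=
  IsCompact M ∧ S ⊆ interior M ∧ S = MaxInvariant γ M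

/-- `S` is an isolated invariant set of the flow `γ`. -/
def IsIsolatedInvSet {X : Type*} [TopologicalSpace X] (γ : ℝ × X → X) (S : Set X) : Prop :=
  FlowInvariant γ S ∧ ∃ M, IsIsolatingNbhd γ S M

/-- `(N₁, N₀)` is an index pair for the isolated invariant set `S` of the flow `γ`:
both sets are compact, `N₀ ⊆ N₁`, the closure of `N₁ \ N₀` is an isolating
neighborhood of `S`, `N₀` is positively invariant in `N₁`, and `N₀` is an exit set. -/
def IsIndexPair {X : Type*} [TopologicalSpace X] (γ : ℝ × X → X) (S N₁ N₀ : Set X) : Prop :=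
  IsCompact N₁ ∧ IsCompact N₀ ∧ N₀ ⊆ N₁ ∧
  S ⊆ interior (closure (N₁ \ N₀)) ∧
  S = MaxInvariant γ (closure (N₁ \ N₀)) ∧
  (∀ x ∈ N₀, ∀ t : ℝ, 0 ≤ t → (∀ s ∈ Set.Icc (0:ℝ) t, γ (s, x) ∈ N₁) →
      ∀ s ∈ Set.Icc (0:ℝ) t, γ (s, x) ∈ N₀) ∧
  (∀ x ∈ N₁, ∀ t₀ : ℝ, 0 < t₀ → γ (t₀, x) ∉ N₁ →
      ∃ τ : ℝ, 0 ≤ τ ∧ (∀ s ∈ Set.Icc (0:ℝ) τ, γ (s, x) ∈ N₁) ∧ γ (τ, x) ∈ N₀)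

theorem MaxInvariant.preimage {E B : Type*} {p : E → B} {γ : ℝ × B → B} {γ' : ℝ × E → E}
    (hlift : ∀ (t : ℝ) (x : E), p (γ' (t, x)) = γ (t, p x)) (M : Set B) :
    p ⁻¹' MaxInvariant γ M = MaxInvariant γ' (p ⁻¹' M) := by
  ext x
  simp [MaxInvariant, hlift]

theorem FlowInvariant.preimage {E B : Type*} {p : E → B} {γ : ℝ × B → B} {γ' : ℝ × E → E}
    (hlift : ∀ (t : ℝ) (x : E), p (γ' (t, x)) = γ (t, p x)) {S : Set B}
    (hS : FlowInvariant γ S) : FlowInvariant γ' (p ⁻¹' S) := fun x hx t => by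
  simpa [hlift] using hS (p x) hx t

theorem IsIsolatingNbhd.preimage {E B : Type*} [TopologicalSpace E] [TopologicalSpace B]
    [CompactSpace E] [T2Space B] {p : E → B} (hp : Continuous p)
    {γ : ℝ × B → B} {γ' : ℝ × E → E}
    (hlift : ∀ (t : ℝ) (x : E), p (γ' (t, x)) = γ (t, p x)) {S M : Set B}
    (hM : IsIsolatingNbhd γ S M) : IsIsolatingNbhd γ' (p ⁻¹' S) (p ⁻¹' M) := by
  obtain ⟨hcompact, hsub, hmax⟩ := hM
  refine ⟨(hcompact.isClosed.preimage hp).isCompact,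
    (Set.preimage_mono hsub).trans (preimage_interior_subset_interior_preimage hp), ?_⟩
  rw [← MaxInvariant.preimage hlift, ← hmax]

theorem preimage_index_pair
    {E B : Type*} [TopologicalSpace E] [TopologicalSpace B]
    [CompactSpace E] [T2Space B]
    (p : E → B) (hp : Continuous p) (hopen : IsOpenMap p)
    (γ : ℝ × B → B) (hγ : IsFlow γ)
    (γ' : ℝ × E → E) (hγ' : IsFlow γ')
    (hlift : ∀ (t : ℝ) (x : E), p (γ' (t, x)) = γ (t, p x))
    (S N₁ N₀ : Set B) (hS : IsIsolatedInvSet γ S)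
    (hpair : IsIndexPair γ S N₁ N₀) :
    IsIsolatedInvSet γ' (p ⁻¹' S) ∧ IsIndexPair γ' (p ⁻¹' S) (p ⁻¹' N₁) (p ⁻¹' N₀) := by
  refine ⟨⟨hS.1.preimage hlift, ?_⟩, ?_⟩
  · obtain ⟨M, hM⟩ := hS.2
    exact ⟨p ⁻¹' M, hM.preimage hp hlift⟩
  obtain ⟨hN₁, hN₀, hsub, hint, hmax, hpos, hexit⟩ := hpair
  have hclosure : closure (p ⁻¹' N₁ \ p ⁻¹' N₀) = p ⁻¹' closure (N₁ \ N₀) := by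
    rw [← Set.preimage_sdiff, hopen.preimage_closure_eq_closure_preimage hp]
  refine ⟨(hN₁.isClosed.preimage hp).isCompact, (hN₀.isClosed.preimage hp).isCompact,
    Set.preimage_mono hsub, ?_, ?_, ?_, ?_⟩
  · rw [hclosure]
    exact (Set.preimage_mono hint).trans (preimage_interior_subset_interior_preimage hp)
  · rw [hclosure, ← MaxInvariant.preimage hlift, ← hmax]
  · intro x hx t ht h
    simp only [Set.mem_preimage, hlift] at hx h ⊢
    exact hpos (p x) hx t ht h
  · intro x hx t₀ ht₀ h
    simp only [Set.mem_preimage, hlift] at hx h ⊢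
    exact hexit (p x) hx t₀ ht₀ h
end

section
/- Let n ≥ 1, let μ : Fin n → ℝ satisfy μ i ≠ 0 for every i, and let v : Fin n → ℝ be nonzero with Σᵢ μ i · (v i)² ≥ 0. Then for every t > 0 one has Σᵢ exp(2 · μ i · t) · (v i)² > Σᵢ (v i)². In particular, a point of the unit sphere at which Σᵢ μ i · (v i)² ≥ 0 is carried strictly outside the closed unit ball by the linear flow v ↦ (exp(μ i · t) · v i)ᵢ for every positive time. -/
/-- A unit-sphere point where the quadratic form `∑ μ i * v i ^ 2` is nonnegative is
carried strictly outside the closed unit ball by the linear flow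
`v ↦ (exp (μ i * t) * v i)ᵢ` for every positive time: the squared norm
`∑ exp (2 * μ i * t) * v i ^ 2` strictly exceeds `∑ v i ^ 2` for all `t > 0`. -/
theorem exit_strictly_increasing_norm
    (n : ℕ) (hn : 1 ≤ n) (μ : Fin n → ℝ) (hμ : ∀ i, μ i ≠ 0)
    (v : Fin n → ℝ) (hv : v ≠ 0) (hq : 0 ≤ ∑ i, μ i * v i ^ 2) :
    ∀ t : ℝ, 0 < t →
      (∑ i, v i ^ 2) < ∑ i, Real.exp (2 * μ i * t) * v i ^ 2 := by
  intro t ht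
  obtain ⟨j, hj⟩ := Function.ne_iff.mp hv
  calc ∑ i, v i ^ 2 ≤ 2 * t * ∑ i, μ i * v i ^ 2 + ∑ i, v i ^ 2 :=
        le_add_of_nonneg_left (by positivity)
    _ = ∑ i, (2 * μ i * t + 1) * v i ^ 2 := by
        rw [Finset.mul_sum, ← Finset.sum_add_distrib]
        exact Finset.sum_congr rfl fun i _ => by ring
    _ < ∑ i, Real.exp (2 * μ i * t) * v i ^ 2 := by
        refine Finset.sum_lt_sum (fun i _ => ?_) ⟨j, Finset.mem_univ j, ?_⟩
        · exact mul_le_mul_of_nonneg_right (Real.add_one_le_exp _) (sq_nonneg _)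
        · exact mul_lt_mul_of_pos_right
            (Real.add_one_lt_exp (mul_ne_zero (mul_ne_zero two_ne_zero (hμ j)) ht.ne'))
            (sq_pos_of_ne_zero hj)
end

section
/- Let γ be a flow on a topological space X, let f, g : X → ℝ be continuous functions such that for every x ∈ X the functions t ↦ f(γ(t, x)) and t ↦ g(γ(t, x)) are nonincreasing on ℝ, and let a, b ∈ ℝ. Set N = {x : f(x) ≥ a} ∩ {x : g(x) ≤ b}. If x ∈ N and γ(t₀, x) ∉ N for some t₀ > 0, then there exists τ ∈ [0, t₀) such that γ(s, x) ∈ N for all s ∈ [0, τ] and f(γ(τ, x)) = a; that is, the forward orbit can only exit N through the face {x ∈ N : f(x) = a}. -/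
/-- If `f` and `g` are continuous and nonincreasing along every orbit of the flow `γ`,
then the forward orbit of a point of `N = {f ≥ a} ∩ {g ≤ b}` can only exit `N`
through the face `{f = a}`. -/
theorem exit_through_face
    {X : Type*} [TopologicalSpace X] (γ : ℝ × X → X) (hγ : IsFlow γ)
    (f g : X → ℝ) (hf : Continuous f) (hg : Continuous g)
    (hfa : ∀ x : X, Antitone (fun t : ℝ => f (γ (t, x))))
    (hga : ∀ x : X, Antitone (fun t : ℝ => g (γ (t, x))))
    (a b : ℝ) (x : X)
    (hx : x ∈ {y : X | a ≤ f y} ∩ {y : X | g y ≤ b})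
    (t₀ : ℝ) (ht₀ : 0 < t₀)
    (hexit : γ (t₀, x) ∉ {y : X | a ≤ f y} ∩ {y : X | g y ≤ b}) :
    ∃ τ ∈ Set.Ico (0 : ℝ) t₀,
      (∀ s ∈ Set.Icc (0 : ℝ) τ, γ (s, x) ∈ {y : X | a ≤ f y} ∩ {y : X | g y ≤ b}) ∧
      f (γ (τ, x)) = a := by
  obtain ⟨hcont, h0, -⟩ := hγ
  obtain ⟨hfx, hgx⟩ := hx
  have hg_le : ∀ s, 0 ≤ s → g (γ (s, x)) ≤ b := fun s hs =>
    (hga x hs).trans (by simpa [h0] using hgx)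
  have hft₀ : f (γ (t₀, x)) < a :=
    not_le.mp fun h => hexit ⟨h, hg_le t₀ ht₀.le⟩
  have hcf : Continuous fun t : ℝ => f (γ (t, x)) := by fun_prop
  obtain ⟨τ, hτ, hfτ⟩ := intermediate_value_Ico' ht₀.le hcf.continuousOn
    (⟨hft₀, by simpa [h0] using hfx⟩ : a ∈ Set.Ioc (f (γ (t₀, x))) (f (γ (0, x))))
  exact ⟨τ, hτ, fun s hs => ⟨hfτ.ge.trans (hfa x hs.2), hg_le s hs.1⟩, hfτ⟩
end

section
/- Let X be a nonempty compact Hausdorff space, let γ be a flow on X, and let f : X → ℝ be continuous with 0 ≤ f(y) ≤ 1 for all y, such that for every y ∈ X the function t ↦ f(γ(t, y)) is nonincreasing on ℝ, and such that for every y with 0 < f(y) < 1 and every t > 0 one has f(γ(t, y)) < f(y). Let a > 0 and let x ∈ X satisfy f(γ(t, x)) ≥ a for all t ≥ 0. Then the ω-limit set of x under γ is contained in f⁻¹({1}). -/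
/-- The ω-limit set of `x` under the flow `γ`. -/
def OmegaSet {X : Type*} [TopologicalSpace X] (γ : ℝ × X → X) (x : X) : Set X :=
  ⋂ T : ℝ, closure ((fun t => γ (t, x)) '' Set.Ici T)

/-- A closed set containing a forward orbit tail of `x` contains the ω-limit set of `x`. -/
theorem OmegaSet.subset_of_isClosed {X : Type*} [TopologicalSpace X] {γ : ℝ × X → X} {x : X}
    {C : Set X} (hC : IsClosed C) (T : ℝ) (h : ∀ t, T ≤ t → γ (t, x) ∈ C) :
    OmegaSet γ x ⊆ C :=
  (Set.iInter_subset _ T).trans (closure_minimal (Set.image_subset_iff.2 h) hC)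

/-- An antitone continuous function on the orbit of `x` takes on the ω-limit set a value at most
each of its values on the orbit. -/
theorem OmegaSet.le_of_antitone {X : Type*} [TopologicalSpace X] {γ : ℝ × X → X} {f : X → ℝ}
    (hf : Continuous f) {x y : X} (hmono : Antitone fun t : ℝ => f (γ (t, x)))
    (hy : y ∈ OmegaSet γ x) (t : ℝ) : f y ≤ f (γ (t, x)) :=
  OmegaSet.subset_of_isClosed (isClosed_le hf continuous_const) t (fun _ hs => hmono hs) hy

/-- For a Lyapunov function `f` with values in `[0,1]`, strictly decreasing along
orbits through points where `0 < f < 1`: if the forward orbit of `x` stays in the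
region `{f ≥ a}` for some `a > 0`, then the ω-limit set of `x` lies in `f⁻¹({1})`. -/
theorem omegaSet_subset_top_level
    {X : Type*} [TopologicalSpace X] [CompactSpace X] [T2Space X] [Nonempty X]
    (γ : ℝ × X → X) (hγ : IsFlow γ)
    (f : X → ℝ) (hf : Continuous f)
    (hf01 : ∀ y : X, 0 ≤ f y ∧ f y ≤ 1)
    (hmono : ∀ y : X, Antitone (fun t : ℝ => f (γ (t, y))))
    (hstrict : ∀ y : X, 0 < f y → f y < 1 → ∀ t : ℝ, 0 < t → f (γ (t, y)) < f y)
    (a : ℝ) (ha : 0 < a) (x : X)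
    (hx : ∀ t : ℝ, 0 ≤ t → a ≤ f (γ (t, x))) :
    OmegaSet γ x ⊆ f ⁻¹' {1} := by
  intro y hy
  have hya : a ≤ f y :=
    OmegaSet.subset_of_isClosed (isClosed_le continuous_const hf) 0 hx hy
  have hcont : Continuous fun z => f (γ (1, z)) :=
    hf.comp (hγ.1.comp (by fun_prop))
  have hle : f y ≤ f (γ (1, y)) := by
    refine OmegaSet.subset_of_isClosed (isClosed_le continuous_const hcont) 0 (fun t _ => ?_) hy
    change f y ≤ f (γ (1, γ (t, x)))
    rw [hγ.2.2]
    exact OmegaSet.le_of_antitone hf (hmono x) hy _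
  by_contra hne
  have hlt : f y < 1 := lt_of_le_of_ne (hf01 y).2 hne
  exact (hstrict y (ha.trans_le hya) hlt 1 one_pos).not_ge hle
end
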